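/- The set Λ(v, w)^st of stable points is nonempty if and only if v_1 ≤ v_2 ≤ ⋯ ≤ v_n ≤ N, where v_k = dim V_k. In that case, the assignment sending (x, y, t) to the tuple of subspaces V'_i := im(t_n ∘ y_{n−1} ∘ y_{n−2} ∘ ⋯ ∘ y_i) ⊆ ℂ^N for 1 ≤ i ≤ n (with V'_n = im t_n) lands in the partial flag variety {0 ⊆ V'_1 ⊆ V'_2 ⊆ ⋯ ⊆ V'_n ⊆ ℂ^N : dim V'_i = v_i} and induces a bijection from the set of G_V-orbits on Λ(v, w)^st onto this partial flag variety. -/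

import Mathlib

open Module

noncomputable section

/-- Transport between the spaces of a family along an equality of indices. -/
def castLEquiv (V : ℕ → Type) [∀ k, AddCommGroup (V k)] [∀ k, Module ℂ (V k)]
    {a b : ℕ} (h : a = b) : V a ≃ₗ[ℂ] V b := by
  subst h; exact LinearEquiv.refl ℂ (V a)

/-- The composite `y_{i+m-1} ∘ ⋯ ∘ y_{i+1} ∘ y_i : V i → V (i+m)`. -/
def ychain (V : ℕ → Type) [∀ k, AddCommGroup (V k)] [∀ k, Module ℂ (V k)]
    (y : ∀ k, V k →ₗ[ℂ] V (k+1)) (i : ℕ) : (m : ℕ) → (V i →ₗ[ℂ] V (i + m))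
  | 0 => LinearMap.id
  | m + 1 => (y (i + m)).comp (ychain V y i m)

/-- A point of `Λ(v, w)^st` for the double quiver of type `A_n` with framing
`W_n = ℂ^N`, `W_k = 0` for `k ≠ n`: maps `x`, `y`, a framing map
`t : V n → ℂ^N`, the moment map relations (recorded at every vertex `k+1`,
`k ∈ ℕ`; at vertices `> n` they hold automatically when the spaces there
vanish), and stability. -/
structure StablePoint (n N : ℕ) (V : ℕ → Type)
    [∀ k, AddCommGroup (V k)] [∀ k, Module ℂ (V k)] where
  x : ∀ k, V (k+1) →ₗ[ℂ] V k
  y : ∀ k, V k →ₗ[ℂ] V (k+1)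
  t : V n →ₗ[ℂ] (Fin N → ℂ)
  mm : ∀ k, (x (k+1)).comp (y (k+1)) = (y k).comp (x k)
  stable : ∀ S : ∀ k, Submodule ℂ (V k),
    (∀ k, Submodule.map (x k) (S (k+1)) ≤ S k) →
    (∀ k, Submodule.map (y k) (S k) ≤ S (k+1)) →
    S n ≤ LinearMap.ker t →
    ∀ k, S k = ⊥

/-- The subspace `V'_i = im (t_n ∘ y_{n-1} ∘ ⋯ ∘ y_i) ⊆ ℂ^N` attached to a point. -/
def flagOf {n N : ℕ} {V : ℕ → Type}
    [∀ k, AddCommGroup (V k)] [∀ k, Module ℂ (V k)]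
    (p : StablePoint n N V) (i : ℕ) : Submodule ℂ (Fin N → ℂ) :=
  if h : i ≤ n then
    LinearMap.range
      (p.t ∘ₗ (castLEquiv V (Nat.add_sub_cancel' h)).toLinearMap ∘ₗ ychain V p.y i (n - i))
  else ⊥

/-- Two points lie in the same `G_V = ∏ GL(V_k)`-orbit. -/
def SameOrbit {n N : ℕ} {V : ℕ → Type}
    [∀ k, AddCommGroup (V k)] [∀ k, Module ℂ (V k)]
    (p q : StablePoint n N V) : Prop :=
  ∃ g : ∀ k, V k ≃ₗ[ℂ] V k,
    (∀ k, q.x k = (g k).toLinearMap ∘ₗ p.x k ∘ₗ ((g (k+1)).symm).toLinearMap) ∧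
    (∀ k, q.y k = (g (k+1)).toLinearMap ∘ₗ p.y k ∘ₗ ((g k).symm).toLinearMap) ∧
    q.t = p.t ∘ₗ ((g n).symm).toLinearMap

lemma castLEquiv_apply_succ (V : ℕ → Type) [∀ k, AddCommGroup (V k)] [∀ k, Module ℂ (V k)]
    (y : ∀ k, V k →ₗ[ℂ] V (k+1)) {a b : ℕ} (h : a = b) (h' : a + 1 = b + 1) (v : V a) :
    castLEquiv V h' (y a v) = y b (castLEquiv V h v) := by
  subst h; rfl

lemma castLEquiv_trans_apply (V : ℕ → Type) [∀ k, AddCommGroup (V k)] [∀ k, Module ℂ (V k)]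
    {a b c : ℕ} (h : a = b) (h' : b = c) (v : V a) :
    castLEquiv V h' (castLEquiv V h v) = castLEquiv V (h.trans h') v := by
  subst h; rfl

/-- Splitting off the first map of the chain instead of the last one. -/
lemma ychain_succ_left (V : ℕ → Type) [∀ k, AddCommGroup (V k)] [∀ k, Module ℂ (V k)]
    (y : ∀ k, V k →ₗ[ℂ] V (k+1)) (i m : ℕ) (h : i + (m + 1) = i + 1 + m) (v : V i) :
    castLEquiv V h (ychain V y i (m + 1) v) = ychain V y (i + 1) m (y i v) := by
  induction m with
  | zero => rfl
  | succ m ih =>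
    have h₁ : i + (m + 1) = i + 1 + m := by omega
    exact (castLEquiv_apply_succ V y h₁ h (ychain V y i (m + 1) v)).trans
      (congrArg (y (i + 1 + m)) (ih h₁))

section StablePoint

variable {n N : ℕ} {V : ℕ → Type} [∀ k, AddCommGroup (V k)] [∀ k, Module ℂ (V k)]

/-- The composite `t ∘ y_{n-1} ∘ ⋯ ∘ y_i : V i → ℂ^N`, and zero for `i > n`. -/
def framedChain (y : ∀ k, V k →ₗ[ℂ] V (k+1)) (t : V n →ₗ[ℂ] (Fin N → ℂ)) (i : ℕ) :
    V i →ₗ[ℂ] (Fin N → ℂ) :=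
  if h : i ≤ n then
    t ∘ₗ (castLEquiv V (Nat.add_sub_cancel' h)).toLinearMap ∘ₗ ychain V y i (n - i)
  else 0

lemma flagOf_eq_range (p : StablePoint n N V) {i : ℕ} (h : i ≤ n) :
    flagOf p i = LinearMap.range (framedChain p.y p.t i) := by
  simp only [flagOf, framedChain, dif_pos h]

lemma framedChain_self (y : ∀ k, V k →ₗ[ℂ] V (k+1)) (t : V n →ₗ[ℂ] (Fin N → ℂ)) :
    framedChain y t n = t := by
  have key : ∀ (m : ℕ) (h : n + m = n) (v : V n),
      castLEquiv V h (ychain V y n m v) = v := by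
    intro m h v
    obtain rfl : m = 0 := by omega
    rfl
  ext1 v
  simp only [framedChain, dif_pos le_rfl, LinearMap.comp_apply, LinearEquiv.coe_coe]
  rw [key]

lemma framedChain_apply_of_lt (y : ∀ k, V k →ₗ[ℂ] V (k+1)) (t : V n →ₗ[ℂ] (Fin N → ℂ))
    {i : ℕ} (h : i < n) (v : V i) :
    framedChain y t i v = framedChain y t (i + 1) (y i v) := by
  have key : ∀ (m m' : ℕ) (_ : m = m' + 1) (h : i + m = n) (h' : i + 1 + m' = n),
      castLEquiv V h (ychain V y i m v) = castLEquiv V h' (ychain V y (i + 1) m' (y i v)) := by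
    rintro m m' rfl h h'
    have h₁ : i + (m' + 1) = i + 1 + m' := by omega
    rw [← ychain_succ_left V y i m' h₁, castLEquiv_trans_apply]
  simp only [framedChain, dif_pos h.le, dif_pos (Nat.succ_le_of_lt h), LinearMap.comp_apply,
    LinearEquiv.coe_coe]
  rw [key _ (n - (i + 1)) (by omega)]

/-- The moment map relations push `t ∘ y_{n-1} ∘ ⋯ ∘ y_k ∘ x_k` past the last vertex. -/
lemma framedChain_x_apply (hVtop : ∀ k, n < k → Subsingleton (V k)) (p : StablePoint n N V)
    {k : ℕ} (hk : k ≤ n) (v : V (k + 1)) : framedChain p.y p.t k (p.x k v) = 0 := by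
  induction hk using Nat.decreasingInduction with
  | self =>
    have := hVtop (n + 1) (Nat.lt_succ_self n)
    rw [Subsingleton.elim v 0, map_zero, map_zero]
  | of_succ k hk ih =>
    have := LinearMap.congr_fun (p.mm k) v
    simp only [LinearMap.comp_apply] at this
    rw [framedChain_apply_of_lt _ _ hk, ← this, ih]

lemma framedChain_injective (hVtop : ∀ k, n < k → Subsingleton (V k)) (p : StablePoint n N V)
    (k : ℕ) : Function.Injective (framedChain p.y p.t k) := by
  rw [← LinearMap.ker_eq_bot]
  refine p.stable (fun k => LinearMap.ker (framedChain p.y p.t k)) ?_ ?_ ?_ k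
  · rintro k _ ⟨v, -, rfl⟩
    rcases le_or_gt k n with h | h
    · exact framedChain_x_apply hVtop p h v
    · have := hVtop k h
      rw [Subsingleton.elim (p.x k v) 0]
      exact zero_mem _
  · rintro k _ ⟨v, hv, rfl⟩
    rcases lt_or_ge k n with h | h
    · exact (framedChain_apply_of_lt _ _ h v).symm.trans hv
    · have := hVtop (k + 1) (by omega)
      rw [Subsingleton.elim (p.y k v) 0]
      exact zero_mem _
  · rw [framedChain_self]

lemma StablePoint.x_eq_zero (hVtop : ∀ k, n < k → Subsingleton (V k)) (p : StablePoint n N V)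
    (k : ℕ) : p.x k = 0 := by
  ext1 v
  rcases le_or_gt k n with h | h
  · exact framedChain_injective hVtop p k
      ((framedChain_x_apply hVtop p h v).trans (map_zero _).symm)
  · have := hVtop k h
    exact Subsingleton.elim _ _

lemma StablePoint.t_injective (hVtop : ∀ k, n < k → Subsingleton (V k))
    (p : StablePoint n N V) : Function.Injective p.t := by
  have := framedChain_injective hVtop p n
  rwa [framedChain_self] at this

lemma StablePoint.y_injective (hVtop : ∀ k, n < k → Subsingleton (V k))
    (p : StablePoint n N V) {k : ℕ} (hk : k < n) : Function.Injective (p.y k) := by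
  intro v w h
  apply framedChain_injective hVtop p k
  rw [framedChain_apply_of_lt _ _ hk, framedChain_apply_of_lt _ _ hk, h]

/-- Injective maps `y_k` and `t` give a stable point with `x = 0`. -/
def StablePoint.ofInjective (hVtop : ∀ k, n < k → Subsingleton (V k))
    (y : ∀ k, V k →ₗ[ℂ] V (k+1)) (t : V n →ₗ[ℂ] (Fin N → ℂ))
    (hy : ∀ k, k < n → Function.Injective (y k)) (ht : Function.Injective t) :
    StablePoint n N V where
  x := 0
  y := y
  t := t
  mm k := by simp
  stable S _ hSy hSt k := by
    rcases le_or_gt k n with h | h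
    · induction h using Nat.decreasingInduction with
      | self => rwa [LinearMap.ker_eq_bot.mpr ht, le_bot_iff] at hSt
      | of_succ k hk ih =>
        have := hSy k
        rwa [ih, Submodule.map_le_iff_le_comap, Submodule.comap_bot,
          LinearMap.ker_eq_bot.mpr (hy k hk), le_bot_iff] at this
    · have := hVtop k h
      exact Subsingleton.elim _ _

/-- A family of embeddings into `ℂ^N` with increasing ranges comes from a stable point. -/
lemma StablePoint.exists_framedChain_eq (hVtop : ∀ k, n < k → Subsingleton (V k))
    (T : ∀ k, V k →ₗ[ℂ] (Fin N → ℂ)) (hT : ∀ k, k ≤ n → Function.Injective (T k))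
    (hle : ∀ k, k < n → LinearMap.range (T k) ≤ LinearMap.range (T (k + 1))) :
    ∃ p : StablePoint n N V, ∀ k, k ≤ n → framedChain p.y p.t k = T k := by
  have hy : ∀ k, ∃ y : V k →ₗ[ℂ] V (k + 1), k < n → ∀ v, T (k + 1) (y v) = T k v := by
    intro k
    by_cases hk : k < n
    · refine ⟨(LinearEquiv.ofInjective (T (k + 1)) (hT _ hk)).symm.toLinearMap ∘ₗ
        (T k).codRestrict _ (fun v => hle k hk (LinearMap.mem_range_self _ v)), fun _ v => ?_⟩
      have h := (LinearEquiv.ofInjective (T (k + 1)) (hT _ hk)).apply_symm_apply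
        ((T k).codRestrict _ (fun v => hle k hk (LinearMap.mem_range_self _ v)) v)
      exact congrArg Subtype.val h
    · exact ⟨0, fun h => absurd h hk⟩
  choose y hy using hy
  refine ⟨StablePoint.ofInjective hVtop y (T n) (fun k hk v w h => hT k hk.le ?_) (hT n le_rfl),
    fun k hk => ?_⟩
  · rw [← hy k hk, ← hy k hk, h]
  · change framedChain y (T n) k = T k
    induction hk using Nat.decreasingInduction with
    | self => exact framedChain_self _ _
    | of_succ k hk ih =>
      ext1 v
      rw [framedChain_apply_of_lt _ _ hk, ih, hy k hk]

lemma SameOrbit.flagOf_eq {p q : StablePoint n N V} (h : SameOrbit p q) {i : ℕ} (hi : i ≤ n) :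
    flagOf p i = flagOf q i := by
  obtain ⟨g, -, hy, ht⟩ := h
  have key : framedChain q.y q.t i ∘ₗ (g i).toLinearMap = framedChain p.y p.t i := by
    induction hi using Nat.decreasingInduction with
    | self =>
      ext1 v
      simp [framedChain_self, ht]
    | of_succ k hk ih =>
      ext1 v
      have := LinearMap.congr_fun ih (p.y k v)
      simp only [LinearMap.comp_apply, LinearEquiv.coe_coe] at this
      rw [framedChain_apply_of_lt _ _ hk, ← this, LinearMap.comp_apply,
        framedChain_apply_of_lt _ _ hk, hy]
      simp
  rw [flagOf_eq_range p hi, flagOf_eq_range q hi, ← key, LinearEquiv.range_comp]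

lemma sameOrbit_of_flagOf_eq (hVtop : ∀ k, n < k → Subsingleton (V k)) {p q : StablePoint n N V}
    (h : ∀ i, i ≤ n → flagOf p i = flagOf q i) : SameOrbit p q := by
  have hg : ∀ k, ∃ g : V k ≃ₗ[ℂ] V k,
      k ≤ n → ∀ v, framedChain q.y q.t k (g v) = framedChain p.y p.t k v := by
    intro k
    by_cases hk : k ≤ n
    · have hr := h k hk
      rw [flagOf_eq_range p hk, flagOf_eq_range q hk] at hr
      let a := LinearEquiv.ofInjective _ (framedChain_injective hVtop p k)
      let b := LinearEquiv.ofInjective _ (framedChain_injective hVtop q k)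
      refine ⟨a.trans ((LinearEquiv.ofEq _ _ hr).trans b.symm), fun _ v => ?_⟩
      exact congrArg Subtype.val (b.apply_symm_apply (LinearEquiv.ofEq _ _ hr (a v)))
    · exact ⟨LinearEquiv.refl ℂ _, fun h => absurd h hk⟩
  choose g hg using hg
  refine ⟨g, fun k => ?_, fun k => ?_, ?_⟩
  · rw [p.x_eq_zero hVtop, q.x_eq_zero hVtop, LinearMap.zero_comp, LinearMap.comp_zero]
  · ext1 v
    rcases lt_or_ge k n with hk | hk
    · apply framedChain_injective hVtop q (k + 1)
      simp only [LinearMap.comp_apply, LinearEquiv.coe_coe]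
      rw [hg (k + 1) hk, ← framedChain_apply_of_lt _ _ hk, ← framedChain_apply_of_lt _ _ hk,
        ← hg k hk.le, LinearEquiv.apply_symm_apply]
    · have := hVtop (k + 1) (by omega)
      exact Subsingleton.elim _ _
  · ext1 v
    have := hg n le_rfl ((g n).symm v)
    rwa [LinearEquiv.apply_symm_apply, framedChain_self, framedChain_self] at this

end StablePoint

/-- For the double quiver of type `A_n` framed by `W_n = ℂ^N`:
(1) the set of stable points `Λ(v, w)^st` is nonempty iff
    `v_1 ≤ v_2 ≤ ⋯ ≤ v_n ≤ N`, where `v_k = dim V_k`;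
(2) for a stable point, the subspaces `V'_i = im (t ∘ y_{n-1} ∘ ⋯ ∘ y_i)` form
    a partial flag `0 ⊆ V'_1 ⊆ ⋯ ⊆ V'_n ⊆ ℂ^N` with `dim V'_i = v_i`;
(3) two stable points give the same partial flag iff they lie in the same
    `G_V`-orbit; and
(4) every such partial flag arises from a stable point.
Together, (2)–(4) say that `(x, y, t) ↦ (V'_i)_i` induces a bijection from the
set of `G_V`-orbits on `Λ(v, w)^st` onto the partial flag variety. -/
theorem quiver_variety_type_A_is_partial_flag_variety
    (n N : ℕ) (hn : 2 ≤ n)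
    (V : ℕ → Type)
    [∀ k, AddCommGroup (V k)] [∀ k, Module ℂ (V k)] [∀ k, FiniteDimensional ℂ (V k)]
    (hV0 : Subsingleton (V 0)) (hVtop : ∀ k, n < k → Subsingleton (V k)) :
    (Nonempty (StablePoint n N V) ↔
      ((∀ k, 1 ≤ k → k + 1 ≤ n → finrank ℂ (V k) ≤ finrank ℂ (V (k+1))) ∧
        finrank ℂ (V n) ≤ N)) ∧
    (∀ p : StablePoint n N V,
      (∀ i, 1 ≤ i → i + 1 ≤ n → flagOf p i ≤ flagOf p (i+1)) ∧
      (∀ i, 1 ≤ i → i ≤ n → finrank ℂ (flagOf p i) = finrank ℂ (V i))) ∧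
    (∀ p q : StablePoint n N V,
      ((∀ i, 1 ≤ i → i ≤ n → flagOf p i = flagOf q i) ↔ SameOrbit p q)) ∧
    (∀ f : ℕ → Submodule ℂ (Fin N → ℂ),
      (∀ i, 1 ≤ i → i + 1 ≤ n → f i ≤ f (i+1)) →
      (∀ i, 1 ≤ i → i ≤ n → finrank ℂ (f i) = finrank ℂ (V i)) →
      ∃ p : StablePoint n N V, ∀ i, 1 ≤ i → i ≤ n → flagOf p i = f i) := by
  refine ⟨⟨fun ⟨p⟩ => ⟨fun k _ hk => ?_, ?_⟩, fun ⟨hV, hN⟩ => ?_⟩, fun p => ⟨fun i _ hi => ?_,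
    fun i _ hi => ?_⟩, fun p q => ⟨fun h => ?_, fun h i _ hi => h.flagOf_eq hi⟩,
    fun f hf hdim => ?_⟩
  · exact LinearMap.finrank_le_finrank_of_injective (p.y_injective hVtop hk)
  · simpa using LinearMap.finrank_le_finrank_of_injective (p.t_injective hVtop)
  · have hy : ∀ k, ∃ y : V k →ₗ[ℂ] V (k + 1), k < n → Function.Injective y := by
      intro k
      by_cases hk : k < n
      · rcases Nat.eq_zero_or_pos k with rfl | h0
        · exact ⟨0, fun _ => Function.injective_of_subsingleton _⟩
        · obtain ⟨y, hy⟩ := finrank_le_iff_exists_linearMap.mp (hV k h0 hk)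
          exact ⟨y, fun _ => hy⟩
      · exact ⟨0, fun h => absurd h hk⟩
    choose y hy using hy
    obtain ⟨t, ht⟩ := finrank_le_iff_exists_linearMap.mp
      (show finrank ℂ (V n) ≤ finrank ℂ (Fin N → ℂ) by simpa using hN)
    exact ⟨StablePoint.ofInjective hVtop y t hy ht⟩
  · rw [flagOf_eq_range p (by omega), flagOf_eq_range p hi]
    rintro _ ⟨v, rfl⟩
    exact ⟨p.y i v, (framedChain_apply_of_lt _ _ hi v).symm⟩
  · rw [flagOf_eq_range p hi]
    exact LinearMap.finrank_range_of_inj (framedChain_injective hVtop p i)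
  · refine sameOrbit_of_flagOf_eq hVtop fun i hi => ?_
    rcases Nat.eq_zero_or_pos i with rfl | h0
    · rw [flagOf_eq_range p hi, flagOf_eq_range q hi, Subsingleton.elim (framedChain p.y p.t 0)]
    · exact h i h0 hi
  · have hT : ∀ k, ∃ T : V k →ₗ[ℂ] (Fin N → ℂ),
        (k ≤ n → Function.Injective T) ∧ (1 ≤ k → k ≤ n → LinearMap.range T = f k) := by
      intro k
      by_cases hk : 1 ≤ k ∧ k ≤ n
      · let e : V k ≃ₗ[ℂ] f k := LinearEquiv.ofFinrankEq _ _ (hdim k hk.1 hk.2).symm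
        refine ⟨(f k).subtype ∘ₗ e.toLinearMap, fun _ => ?_, fun _ _ => ?_⟩
        · exact (f k).injective_subtype.comp e.injective
        · rw [LinearEquiv.range_comp, Submodule.range_subtype]
      · refine ⟨0, fun h => ?_, fun h1 h2 => absurd ⟨h1, h2⟩ hk⟩
        obtain rfl : k = 0 := by omega
        exact Function.injective_of_subsingleton _
    choose T hTinj hTrange using hT
    obtain ⟨p, hp⟩ := StablePoint.exists_framedChain_eq hVtop T hTinj fun k hk => by
      rcases Nat.eq_zero_or_pos k with rfl | h0
      · rintro _ ⟨v, rfl⟩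
        rw [Subsingleton.elim v 0, map_zero]
        exact zero_mem _
      · rw [hTrange k h0 hk.le, hTrange (k + 1) (by omega) hk]
        exact hf k h0 hk
    refine ⟨p, fun i h1 hi => ?_⟩
    rw [flagOf_eq_range p hi, hp i hi, hTrange i h1 hi]

end
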